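/- arXiv:1801.03071 — 4 statements merged into one kernel-verified Lean document; each statement's English description precedes it below -/
import Mathlib

section
/- Strict cyclic monogamy for odd cycles: Let h ≥ 5 be odd and consider 2h qubits labeled 1,…,2h arranged in the cyclic hypergraph C_h with hyperedges e_j = (2j−1, 2j, 2j+1) for j = 1,…,h, where the label 2h+1 is identified with 1. Then for every 2h-qubit density matrix ρ the averaged bound 2h is never attained: Σ_{j=1}^{h} 𝒯²_{e_j}(ρ) < 2h. -/
open Matrix Complex ComplexOrder

noncomputable section

/-- The Pauli X matrix. -/
def pX : Matrix (Fin 2) (Fin 2) ℂ := !![0, 1; 1, 0]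

/-- The Pauli Y matrix. -/
def pY : Matrix (Fin 2) (Fin 2) ℂ := !![0, -Complex.I; Complex.I, 0]

/-- The Pauli Z matrix. -/
def pZ : Matrix (Fin 2) (Fin 2) ℂ := !![1, 0; 0, -1]

/-- The operator on `n` qubits acting as the single-qubit operator `M` on qubit `i`
and as the identity on all other qubits. -/
def onQubit {n : ℕ} (M : Matrix (Fin 2) (Fin 2) ℂ) (i : Fin n) :
    Matrix (Fin n → Fin 2) (Fin n → Fin 2) ℂ :=
  Matrix.of fun a b => ∏ s, if s = i then M (a s) (b s) else (if a s = b s then 1 else 0)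

/-- An `n`-qubit density matrix: positive semidefinite with unit trace. -/
def IsDensityMatrix {n : ℕ} (ρ : Matrix (Fin n → Fin 2) (Fin n → Fin 2) ℂ) : Prop :=
  ρ.PosSemidef ∧ ρ.trace = 1

/-- The two Pauli matrices spanning the xy plane. -/
def XY : Fin 2 → Matrix (Fin 2) (Fin 2) ℂ := ![pX, pY]

/-- The two Pauli matrices spanning the xz plane. -/
def XZ : Fin 2 → Matrix (Fin 2) (Fin 2) ℂ := ![pX, pZ]

/-- The xy-plane Bell strength 𝒯²_{ij}(ρ) of the pair of qubits (i,j). -/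
def T2pair {n : ℕ} (ρ : Matrix (Fin n → Fin 2) (Fin n → Fin 2) ℂ) (i j : Fin n) : ℝ :=
  ∑ k : Fin 2, ∑ l : Fin 2,
    ((ρ * (onQubit (XY k) i * onQubit (XY l) j)).trace.re) ^ 2

/-- The xy-plane Bell strength 𝒯²_{ijm}(ρ) of the triple of qubits (i,j,m). -/
def T2triple {n : ℕ} (ρ : Matrix (Fin n → Fin 2) (Fin n → Fin 2) ℂ) (i j m : Fin n) : ℝ :=
  ∑ k : Fin 2, ∑ l : Fin 2, ∑ p : Fin 2,
    ((ρ * (onQubit (XY k) i * onQubit (XY l) j * onQubit (XY p) m)).trace.re) ^ 2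

/-- The xy-plane Bell strength 𝒯²_{ijml}(ρ) of the quadruple of qubits (i,j,m,l). -/
def T2quad {n : ℕ} (ρ : Matrix (Fin n → Fin 2) (Fin n → Fin 2) ℂ) (i j m l : Fin n) : ℝ :=
  ∑ k : Fin 2, ∑ k' : Fin 2, ∑ k'' : Fin 2, ∑ k''' : Fin 2,
    ((ρ * (onQubit (XY k) i * onQubit (XY k') j * onQubit (XY k'') m *
        onQubit (XY k''') l)).trace.re) ^ 2

/-- The xz-plane Bell strength of the pair of qubits (i,j). -/
def T2pairXZ {n : ℕ} (ρ : Matrix (Fin n → Fin 2) (Fin n → Fin 2) ℂ) (i j : Fin n) : ℝ :=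
  ∑ k : Fin 2, ∑ l : Fin 2,
    ((ρ * (onQubit (XZ k) i * onQubit (XZ l) j)).trace.re) ^ 2

/-- The tensor product of a family of single-qubit operators. -/
def tensorOp {n : ℕ} (f : Fin n → Matrix (Fin 2) (Fin 2) ℂ) :
    Matrix (Fin n → Fin 2) (Fin n → Fin 2) ℂ :=
  Matrix.of fun a b => ∏ s, f s (a s) (b s)

lemma tensorOp_mul {n : ℕ} (f g : Fin n → Matrix (Fin 2) (Fin 2) ℂ) :
    tensorOp f * tensorOp g = tensorOp (f * g) := by
  ext a b
  simp only [tensorOp, Matrix.mul_apply, Matrix.of_apply, Pi.mul_apply,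
    Finset.prod_univ_sum, Fintype.piFinset_univ, Finset.prod_mul_distrib]

lemma tensorOp_one {n : ℕ} : tensorOp (1 : Fin n → Matrix (Fin 2) (Fin 2) ℂ) = 1 := by
  ext a b
  simp only [tensorOp, Matrix.of_apply, Pi.one_apply, Matrix.one_apply, Finset.prod_ite_zero,
    Finset.prod_const_one, Finset.mem_univ, true_implies, funext_iff]

lemma onQubit_eq_tensorOp {n : ℕ} (M : Matrix (Fin 2) (Fin 2) ℂ) (i : Fin n) :
    onQubit M i = tensorOp (Pi.mulSingle i M) := by
  ext a b
  simp only [onQubit, tensorOp, Matrix.of_apply]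
  refine Finset.prod_congr rfl fun s _ => ?_
  by_cases hs : s = i
  · subst hs; simp
  · simp [hs, Matrix.one_apply]

lemma onQubit_mul {n : ℕ} (M N : Matrix (Fin 2) (Fin 2) ℂ) (i : Fin n) :
    onQubit M i * onQubit N i = onQubit (M * N) i := by
  simp only [onQubit_eq_tensorOp, tensorOp_mul, Pi.mulSingle_mul]

lemma onQubit_one {n : ℕ} (i : Fin n) : onQubit 1 i = 1 := by
  rw [onQubit_eq_tensorOp, Pi.mulSingle_one, tensorOp_one]

lemma onQubit_neg {n : ℕ} (M : Matrix (Fin 2) (Fin 2) ℂ) (i : Fin n) :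
    onQubit (-M) i = -onQubit M i := by
  ext a b
  have key : ∀ N : Matrix (Fin 2) (Fin 2) ℂ, onQubit N i a b =
      N (a i) (b i) * ∏ s ∈ Finset.univ.erase i, if a s = b s then 1 else 0 := by
    intro N
    rw [onQubit, Matrix.of_apply, ← Finset.mul_prod_erase _ _ (Finset.mem_univ i), if_pos rfl]
    congr 1
    exact Finset.prod_congr rfl fun s hs => if_neg (Finset.ne_of_mem_erase hs)
  rw [Matrix.neg_apply, key, key, Matrix.neg_apply, neg_mul]

lemma onQubit_commute {n : ℕ} (M N : Matrix (Fin 2) (Fin 2) ℂ) {i j : Fin n} (hij : i ≠ j) :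
    onQubit M i * onQubit N j = onQubit N j * onQubit M i := by
  simp only [onQubit_eq_tensorOp, tensorOp_mul]
  exact congrArg tensorOp
    (Pi.mulSingle_commute (f := fun _ : Fin n => Matrix (Fin 2) (Fin 2) ℂ) hij M N).eq

lemma onQubit_isHermitian {n : ℕ} {M : Matrix (Fin 2) (Fin 2) ℂ} (hM : M.IsHermitian)
    (i : Fin n) : (onQubit M i).IsHermitian := by
  ext a b
  simp only [onQubit, Matrix.conjTranspose_apply, Matrix.of_apply, star_prod]
  refine Finset.prod_congr rfl fun s _ => ?_
  split_ifs with h₁ h₂ h₃ h₃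
  · exact hM.apply _ _
  · simp
  · exact absurd h₂.symm h₃
  · exact absurd h₃.symm h₂
  · simp

lemma XY_isHermitian (k : Fin 2) : (XY k).IsHermitian := by
  fin_cases k <;> ext a b <;> fin_cases a <;> fin_cases b <;> simp [XY, pX, pY]

lemma XY_mul_self (k : Fin 2) : XY k * XY k = 1 := by
  fin_cases k <;> ext a b <;> fin_cases a <;> fin_cases b <;> simp [XY, pX, pY]

lemma XY_anticommute {k l : Fin 2} (hkl : k ≠ l) : XY k * XY l = -(XY l * XY k) := by
  fin_cases k <;> fin_cases l <;> first | exact absurd rfl hkl | skip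
  all_goals ext a b; fin_cases a <;> fin_cases b <;> simp [XY, pX, pY]

/-- `A` and `B` commute up to the sign `ε`. -/
def SignCommute {R : Type*} [Ring R] (ε : ℤ) (A B : R) : Prop := A * B = ε • (B * A)

namespace SignCommute

variable {R : Type*} [Ring R] {ε δ : ℤ} {A B C : R}

lemma mul_right (h₁ : SignCommute ε A B) (h₂ : SignCommute δ A C) :
    SignCommute (ε * δ) A (B * C) := by
  unfold SignCommute at *
  rw [← mul_assoc, h₁, smul_mul_assoc, mul_assoc, h₂, mul_smul_comm, smul_smul, mul_assoc]

lemma mul_left (h₁ : SignCommute ε A C) (h₂ : SignCommute δ B C) :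
    SignCommute (ε * δ) (A * B) C := by
  unfold SignCommute at *
  rw [mul_assoc, h₂, mul_smul_comm, ← mul_assoc, h₁, smul_mul_assoc, smul_smul, mul_assoc,
    mul_comm]

end SignCommute

/-- The sign with which two Pauli matrices of the xy plane commute. -/
def pauliSign (k l : Fin 2) : ℤ := if k = l then 1 else -1

lemma pauliSign_self (k : Fin 2) : pauliSign k k = 1 := if_pos rfl

lemma pauliSign_comm (k l : Fin 2) : pauliSign k l = pauliSign l k := by
  revert k l; decide

lemma pauliSign_sub_left (k l : Fin 2) : pauliSign (1 - k) l = -pauliSign k l := by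
  revert k l; decide

lemma pauliSign_sub_right (k l : Fin 2) : pauliSign k (1 - l) = -pauliSign k l := by
  revert k l; decide

lemma pauliSign_eq (k l : Fin 2) : pauliSign k l = 1 ∨ pauliSign k l = -1 := by
  revert k l; decide

lemma signCommute_same {n : ℕ} (k l : Fin 2) (i : Fin n) :
    SignCommute (pauliSign k l) (onQubit (XY k) i) (onQubit (XY l) i) := by
  unfold SignCommute pauliSign
  split_ifs with hkl
  · rw [hkl, one_smul]
  · rw [onQubit_mul, XY_anticommute hkl, onQubit_neg, onQubit_mul, neg_smul, one_smul]

lemma signCommute_of_ne {n : ℕ} (k l : Fin 2) {i j : Fin n} (hij : i ≠ j) :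
    SignCommute 1 (onQubit (XY k) i) (onQubit (XY l) j) := by
  rw [SignCommute, one_smul, onQubit_commute _ _ hij]

/-- The three-qubit observable `σ_k ⊗ σ_l ⊗ σ_p` on the qubits `i, j, m`. -/
def tripleOp {n : ℕ} (i j m : Fin n) (k l p : Fin 2) :
    Matrix (Fin n → Fin 2) (Fin n → Fin 2) ℂ :=
  onQubit (XY k) i * onQubit (XY l) j * onQubit (XY p) m

section tripleOp

variable {n : ℕ} {i j m : Fin n}

lemma tripleOp_mul_self (hij : i ≠ j) (him : i ≠ m) (hjm : j ≠ m) (k l p : Fin 2) :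
    tripleOp i j m k l p * tripleOp i j m k l p = 1 := by
  have sq : ∀ (k : Fin 2) (i : Fin n), onQubit (XY k) i * onQubit (XY k) i = 1 := fun k i => by
    rw [onQubit_mul, XY_mul_self, onQubit_one]
  have h₁ := onQubit_commute (XY k) (XY l) hij
  have h₂ := onQubit_commute (XY k) (XY p) him
  have h₃ := onQubit_commute (XY l) (XY p) hjm
  have h₁₂ : Commute (onQubit (XY k) i * onQubit (XY l) j) (onQubit (XY p) m) :=
    Commute.mul_left h₂ h₃
  unfold tripleOp
  rw [h₁₂.symm.mul_mul_mul_comm, Commute.mul_mul_mul_comm h₁.symm, sq, sq, sq, one_mul, one_mul]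

lemma tripleOp_isHermitian (hij : i ≠ j) (him : i ≠ m) (hjm : j ≠ m) (k l p : Fin 2) :
    (tripleOp i j m k l p).IsHermitian := by
  have h (k : Fin 2) (i : Fin n) := (onQubit_isHermitian (XY_isHermitian k) i).eq
  rw [tripleOp, Matrix.IsHermitian, conjTranspose_mul, conjTranspose_mul, h, h, h,
    onQubit_commute (XY l) (XY k) hij.symm, ← mul_assoc,
    onQubit_commute (XY p) (XY k) him.symm, mul_assoc,
    onQubit_commute (XY p) (XY l) hjm.symm, ← mul_assoc]

lemma tripleOp_signCommute (hij : i ≠ j) (him : i ≠ m) (hjm : j ≠ m) (k l p k' l' p' : Fin 2) :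
    SignCommute (pauliSign k k' * pauliSign l l' * pauliSign p p')
      (tripleOp i j m k l p) (tripleOp i j m k' l' p') := by
  have := ((((signCommute_same k k' i).mul_left (signCommute_of_ne l k' hij.symm)).mul_left
      (signCommute_of_ne p k' him.symm)).mul_right
    (((signCommute_of_ne k l' hij).mul_left (signCommute_same l l' j)).mul_left
      (signCommute_of_ne p l' hjm.symm))).mul_right
    (((signCommute_of_ne k p' him).mul_left (signCommute_of_ne l p' hjm)).mul_left
      (signCommute_same p p' m))
  simpa [tripleOp] using this

lemma tripleOp_signCommute_adjacent {a b : Fin n} (him : i ≠ m) (hia : i ≠ a)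
    (hib : i ≠ b) (hjm : j ≠ m) (hja : j ≠ a) (hjb : j ≠ b) (hma : m ≠ a) (hmb : m ≠ b)
    (k l p k' l' p' : Fin 2) :
    SignCommute (pauliSign p k') (tripleOp i j m k l p) (tripleOp m a b k' l' p') := by
  have := ((((signCommute_of_ne k k' him).mul_left (signCommute_of_ne l k' hjm)).mul_left
      (signCommute_same p k' m)).mul_right
    (((signCommute_of_ne k l' hia).mul_left (signCommute_of_ne l l' hja)).mul_left
      (signCommute_of_ne p l' hma))).mul_right
    (((signCommute_of_ne k p' hib).mul_left (signCommute_of_ne l p' hjb)).mul_left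
      (signCommute_of_ne p p' hmb))
  simpa [tripleOp] using this

end tripleOp

section State

variable {α : Type*} [Fintype α] {ρ : Matrix α α ℂ}

lemma trace_conj_re_nonneg (hρ : ρ.PosSemidef) (M : Matrix α α ℂ) :
    0 ≤ (M * ρ * Mᴴ).trace.re :=
  (Complex.le_def.1 (hρ.mul_mul_conjTranspose_same M).trace_nonneg).1

variable [DecidableEq α]

open scoped MatrixOrder Matrix.Norms.L2Operator in
lemma mul_eq_zero_of_trace_conj_re (hρ : ρ.PosSemidef) {M : Matrix α α ℂ}
    (h : (M * ρ * Mᴴ).trace.re = 0) : M * ρ = 0 := by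
  have hps := hρ.mul_mul_conjTranspose_same M
  have h0 : M * ρ * Mᴴ = 0 :=
    hps.trace_eq_zero_iff.1 (Complex.ext h (Complex.le_def.1 hps.trace_nonneg).2.symm)
  obtain ⟨B, rfl⟩ := CStarAlgebra.nonneg_iff_eq_star_mul_self.mp hρ.nonneg
  rw [star_eq_conjTranspose] at h0 ⊢
  have hB : M * Bᴴ = 0 := by
    rw [← Matrix.self_mul_conjTranspose_eq_zero, conjTranspose_mul, conjTranspose_conjTranspose,
      ← h0]
    simp only [mul_assoc]
  rw [← mul_assoc, hB, zero_mul]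

variable {ι : Type*} [Fintype ι] [DecidableEq ι] {A : ι → Matrix α α ℂ}

/-- The combination of the observables `A i` weighted by their expectation values. -/
def expectationSum (ρ : Matrix α α ℂ) (A : ι → Matrix α α ℂ) : Matrix α α ℂ :=
  ∑ i, ((ρ * A i).trace.re : ℂ) • A i

lemma expectationSum_mul_self (hsq : ∀ i, A i * A i = 1)
    (hac : ∀ i j, i ≠ j → A i * A j = -(A j * A i)) :
    expectationSum ρ A * expectationSum ρ A =
      ((∑ i, (ρ * A i).trace.re ^ 2 : ℝ) : ℂ) • 1 := by
  set a : ι → ℂ := fun i => ((ρ * A i).trace.re : ℂ) with ha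
  have e₁ : expectationSum ρ A * expectationSum ρ A =
      ∑ i, ∑ j, (a i * a j) • (A i * A j) := by
    simp only [expectationSum, Finset.sum_mul_sum, smul_mul_smul_comm, ha]
  have e₂ : expectationSum ρ A * expectationSum ρ A =
      ∑ i, ∑ j, (a i * a j) • (A j * A i) := by
    rw [e₁, Finset.sum_comm]
    exact Finset.sum_congr rfl fun i _ => Finset.sum_congr rfl fun j _ => by rw [mul_comm (a j)]
  have e₃ : (2 : ℂ) • (expectationSum ρ A * expectationSum ρ A) =
      ∑ i, ∑ j, if i = j then (2 * (a i * a i)) • (1 : Matrix α α ℂ) else 0 := by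
    rw [two_smul]
    nth_rw 1 [e₁]
    rw [e₂, ← Finset.sum_add_distrib]
    refine Finset.sum_congr rfl fun i _ => ?_
    rw [← Finset.sum_add_distrib]
    refine Finset.sum_congr rfl fun j _ => ?_
    split_ifs with hij
    · rw [← hij, hsq, ← two_smul ℂ, smul_smul]
    · rw [hac i j hij, smul_neg, neg_add_cancel]
  refine smul_right_injective _ (two_ne_zero' ℂ) ?_
  simp only [e₃, Finset.sum_ite_eq, Finset.mem_univ, if_true, smul_smul, ← Finset.sum_smul,
    ← Finset.mul_sum, ha]
  push_cast
  simp only [sq]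

lemma trace_one_sub_expectationSum (htr : ρ.trace = 1) (hherm : ∀ i, (A i).IsHermitian)
    (hsq : ∀ i, A i * A i = 1) (hac : ∀ i j, i ≠ j → A i * A j = -(A j * A i)) :
    ((1 - expectationSum ρ A) * ρ * (1 - expectationSum ρ A)ᴴ).trace.re =
      1 - ∑ i, (ρ * A i).trace.re ^ 2 := by
  have hO : (expectationSum ρ A)ᴴ = expectationSum ρ A := by
    simp only [expectationSum, conjTranspose_sum, conjTranspose_smul, (hherm _).eq,
      RCLike.star_def, Complex.conj_ofReal]
  have htrO : (ρ * expectationSum ρ A).trace.re = ∑ i, (ρ * A i).trace.re ^ 2 := by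
    simp only [expectationSum, Finset.mul_sum, mul_smul_comm, trace_sum, trace_smul, smul_eq_mul,
      Complex.re_sum, Complex.re_ofReal_mul, sq]
  have hmul : (1 - expectationSum ρ A) * (1 - expectationSum ρ A) =
      1 - expectationSum ρ A - expectationSum ρ A + expectationSum ρ A * expectationSum ρ A := by
    noncomm_ring
  rw [conjTranspose_sub, conjTranspose_one, hO, trace_mul_comm, ← mul_assoc, trace_mul_comm,
    hmul, expectationSum_mul_self hsq hac, mul_add, mul_sub, mul_sub, mul_one, mul_smul_comm,
    mul_one, trace_add, trace_sub, trace_sub, trace_smul, htr, smul_eq_mul, mul_one,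
    Complex.add_re, Complex.sub_re, Complex.sub_re, htrO, Complex.ofReal_re, Complex.one_re]
  ring

/-- The squared expectation values of pairwise anticommuting involutions sum to at most one. -/
lemma sum_sq_le_one (hρ : ρ.PosSemidef) (htr : ρ.trace = 1) (hherm : ∀ i, (A i).IsHermitian)
    (hsq : ∀ i, A i * A i = 1) (hac : ∀ i j, i ≠ j → A i * A j = -(A j * A i)) :
    ∑ i, (ρ * A i).trace.re ^ 2 ≤ 1 := by
  have := trace_conj_re_nonneg hρ (1 - expectationSum ρ A)
  rw [trace_one_sub_expectationSum htr hherm hsq hac] at this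
  linarith

/-- If the bound `sum_sq_le_one` is attained, `expectationSum ρ A` stabilizes the state. -/
lemma expectationSum_mul_eq (hρ : ρ.PosSemidef) (htr : ρ.trace = 1)
    (hherm : ∀ i, (A i).IsHermitian) (hsq : ∀ i, A i * A i = 1)
    (hac : ∀ i j, i ≠ j → A i * A j = -(A j * A i))
    (heq : ∑ i, (ρ * A i).trace.re ^ 2 = 1) : expectationSum ρ A * ρ = ρ := by
  have := mul_eq_zero_of_trace_conj_re hρ (M := 1 - expectationSum ρ A) (by
    rw [trace_one_sub_expectationSum htr hherm hsq hac, heq, sub_self])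
  rw [sub_mul, one_mul, sub_eq_zero] at this
  exact this.symm

/-- If `A₁` and `A₂` act proportionally on the state, then any observable anticommuting with
exactly one of them has vanishing expectation. -/
lemma trace_eq_zero_of_proportional (hρ : ρ.IsHermitian) {A₁ A₂ B : Matrix α α ℂ}
    (h₁ : A₁.IsHermitian) (h₂ : A₂.IsHermitian) (s₁ : A₁ * A₁ = 1) (s₂ : A₂ * A₂ = 1)
    {a₁ a₂ : ℝ} (ha : a₁ ^ 2 + a₂ ^ 2 ≠ 0) (hprop : (a₁ : ℂ) • (A₁ * ρ) = (a₂ : ℂ) • (A₂ * ρ))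
    {ε : ℤ} (hε : ε = 1 ∨ ε = -1) (c₁ : SignCommute ε A₁ B) (c₂ : SignCommute (-ε) A₂ B) :
    (ρ * B).trace = 0 := by
  have hprop' : (a₁ : ℂ) • (ρ * A₁) = (a₂ : ℂ) • (ρ * A₂) := by
    have := congrArg conjTranspose hprop
    simpa only [conjTranspose_smul, conjTranspose_mul, h₁.eq, h₂.eq, hρ.eq, RCLike.star_def,
      Complex.conj_ofReal] using this
  have hconj : ((a₁ : ℂ) ^ 2) • (A₁ * ρ * A₁) = ((a₂ : ℂ) ^ 2) • (A₂ * ρ * A₂) := by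
    calc ((a₁ : ℂ) ^ 2) • (A₁ * ρ * A₁) = (a₁ : ℂ) • (((a₁ : ℂ) • (A₁ * ρ)) * A₁) := by
          rw [smul_mul_assoc, smul_smul, sq]
      _ = (a₂ : ℂ) • (A₂ * ((a₁ : ℂ) • (ρ * A₁))) := by
          rw [hprop, smul_mul_assoc, mul_smul_comm, mul_assoc, smul_comm]
      _ = ((a₂ : ℂ) ^ 2) • (A₂ * ρ * A₂) := by
          rw [hprop', mul_smul_comm, smul_smul, sq, mul_assoc]
  have tr : ∀ {C : Matrix α α ℂ} {δ : ℤ}, C * C = 1 → SignCommute δ C B →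
      (C * ρ * C * B).trace = δ * (ρ * B).trace := by
    intro C δ hC hc
    rw [mul_assoc, hc, mul_smul_comm, trace_smul, trace_mul_comm, mul_assoc, ← mul_assoc C, hC,
      one_mul, trace_mul_comm, zsmul_eq_mul]
  have key := congrArg (fun M => (M * B).trace) hconj
  simp only [smul_mul_assoc, trace_smul, tr s₁ c₁, tr s₂ c₂, smul_eq_mul] at key
  have ha' : (a₁ : ℂ) ^ 2 + (a₂ : ℂ) ^ 2 ≠ 0 := by exact_mod_cast ha
  refine (mul_eq_zero.1 (?_ : ((a₁ : ℂ) ^ 2 + (a₂ : ℂ) ^ 2) * (ρ * B).trace = 0)).resolve_left ha'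
  rcases hε with rfl | rfl <;> push_cast at key
  · linear_combination key
  · linear_combination -key

end State

section Clique

variable {n : ℕ} {q : Fin 7 → Fin n}

/-- Two observables on the qubits `q 2, q 3, q 4` with Pauli matrix `k` on the qubit `q 2`, and two
observables on `q 0, q 1, q 2` with the other Pauli matrix on `q 2`. -/
def clique (q : Fin 7 → Fin n) (k l m l' m' y : Fin 2) :
    Fin 4 → Matrix (Fin n → Fin 2) (Fin n → Fin 2) ℂ :=
  ![tripleOp (q 2) (q 3) (q 4) k l m, tripleOp (q 2) (q 3) (q 4) k l' m',
    tripleOp (q 0) (q 1) (q 2) 0 y (1 - k), tripleOp (q 0) (q 1) (q 2) 1 y (1 - k)]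

lemma clique_isHermitian (hq : q.Injective) (k l m l' m' y : Fin 2) (i : Fin 4) :
    (clique q k l m l' m' y i).IsHermitian := by
  fin_cases i <;>
    exact tripleOp_isHermitian (hq.ne (by decide)) (hq.ne (by decide)) (hq.ne (by decide)) _ _ _

lemma clique_mul_self (hq : q.Injective) (k l m l' m' y : Fin 2) (i : Fin 4) :
    clique q k l m l' m' y i * clique q k l m l' m' y i = 1 := by
  fin_cases i <;>
    exact tripleOp_mul_self (hq.ne (by decide)) (hq.ne (by decide)) (hq.ne (by decide)) _ _ _

lemma clique_anticommute (hq : q.Injective) (k : Fin 2) {l m l' m' : Fin 2}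
    (hs : pauliSign l l' * pauliSign m m' = -1) (y : Fin 2) (i j : Fin 4) (hij : i ≠ j) :
    clique q k l m l' m' y i * clique q k l m l' m' y j =
      -(clique q k l m l' m' y j * clique q k l m l' m' y i) := by
  have hflip : pauliSign (1 - k) k = -1 := by rw [pauliSign_sub_left, pauliSign_self]
  have hlt : ∀ i j : Fin 4, i < j →
      SignCommute (-1) (clique q k l m l' m' y j) (clique q k l m l' m' y i) := by
    have h₀₁ : SignCommute (-1) (tripleOp (q 2) (q 3) (q 4) k l' m')
        (tripleOp (q 2) (q 3) (q 4) k l m) := by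
      have := tripleOp_signCommute (hq.ne (by decide : (2 : Fin 7) ≠ 3))
        (hq.ne (by decide : (2 : Fin 7) ≠ 4)) (hq.ne (by decide : (3 : Fin 7) ≠ 4)) k l' m' k l m
      rwa [pauliSign_self, one_mul, pauliSign_comm l', pauliSign_comm m', hs] at this
    have h₂₃ : SignCommute (-1) (tripleOp (q 0) (q 1) (q 2) 1 y (1 - k))
        (tripleOp (q 0) (q 1) (q 2) 0 y (1 - k)) := by
      have := tripleOp_signCommute (hq.ne (by decide : (0 : Fin 7) ≠ 1))
        (hq.ne (by decide : (0 : Fin 7) ≠ 2)) (hq.ne (by decide : (1 : Fin 7) ≠ 2))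
        1 y (1 - k) 0 y (1 - k)
      rwa [pauliSign_self, pauliSign_self, mul_one, mul_one] at this
    have hadj : ∀ x a b, SignCommute (-1) (tripleOp (q 0) (q 1) (q 2) x y (1 - k))
        (tripleOp (q 2) (q 3) (q 4) k a b) := fun x a b => by
      rw [← hflip]
      refine tripleOp_signCommute_adjacent ?_ ?_ ?_ ?_ ?_ ?_ ?_ ?_ _ _ _ _ _ _ <;>
        exact hq.ne (by decide)
    intro i j hij
    fin_cases i <;> fin_cases j <;> first | exact absurd hij (by decide) | skip
    · exact h₀₁
    · exact hadj 0 l m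
    · exact hadj 1 l m
    · exact hadj 0 l' m'
    · exact hadj 1 l' m'
    · exact h₂₃
  have hneg : ∀ {A B : Matrix (Fin n → Fin 2) (Fin n → Fin 2) ℂ}, SignCommute (-1) A B →
      A * B = -(B * A) := fun h => by rw [h, neg_smul, one_smul]
  rcases lt_or_gt_of_ne hij with h | h
  · rw [hneg (hlt i j h), neg_neg]
  · exact hneg (hlt j i h)

variable {ρ : Matrix (Fin n → Fin 2) (Fin n → Fin 2) ℂ}

lemma clique_sum_le_one (hρ : IsDensityMatrix ρ) (hq : q.Injective) (k : Fin 2)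
    {l m l' m' : Fin 2} (hs : pauliSign l l' * pauliSign m m' = -1) (y : Fin 2) :
    ∑ i, (ρ * clique q k l m l' m' y i).trace.re ^ 2 ≤ 1 :=
  sum_sq_le_one hρ.1 hρ.2 (clique_isHermitian hq _ _ _ _ _ _) (clique_mul_self hq _ _ _ _ _ _)
    (clique_anticommute hq k hs y)

lemma T2triple_eq (i j m : Fin n) :
    T2triple ρ i j m = ∑ k, ∑ l, ∑ p, (ρ * tripleOp i j m k l p).trace.re ^ 2 := rfl

lemma sum_clique (k l m l' m' y : Fin 2) :
    ∑ i, (ρ * clique q k l m l' m' y i).trace.re ^ 2 =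
      (ρ * tripleOp (q 2) (q 3) (q 4) k l m).trace.re ^ 2 +
      (ρ * tripleOp (q 2) (q 3) (q 4) k l' m').trace.re ^ 2 +
      (ρ * tripleOp (q 0) (q 1) (q 2) 0 y (1 - k)).trace.re ^ 2 +
      (ρ * tripleOp (q 0) (q 1) (q 2) 1 y (1 - k)).trace.re ^ 2 := by
  simp [Fin.sum_univ_four, clique]

/-- Monogamy relation for two hyperedges sharing one qubit. -/
lemma T2triple_add_le_four (hρ : IsDensityMatrix ρ) (hq : q.Injective) :
    T2triple ρ (q 0) (q 1) (q 2) + T2triple ρ (q 2) (q 3) (q 4) ≤ 4 := by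
  have hb := fun k l y : Fin 2 => clique_sum_le_one hρ hq k (l := l) (m := 0) (l' := l) (m' := 1)
    (by rw [pauliSign_self]; decide) y
  simp only [sum_clique] at hb
  have h₁ := hb 0 0 0
  have h₂ := hb 0 1 1
  have h₃ := hb 1 0 0
  have h₄ := hb 1 1 1
  simp only [T2triple_eq, Fin.sum_univ_two]
  simp only [sub_zero, sub_self] at h₁ h₂ h₃ h₄
  linarith

/-- If the monogamy relation is attained, so is the bound of every clique. -/
lemma clique_sum_eq_one (hρ : IsDensityMatrix ρ) (hq : q.Injective)
    (h4 : T2triple ρ (q 0) (q 1) (q 2) + T2triple ρ (q 2) (q 3) (q 4) = 4) (k : Fin 2)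
    {l m l' m' : Fin 2} (hs : pauliSign l l' * pauliSign m m' = -1) (y : Fin 2) :
    ∑ i, (ρ * clique q k l m l' m' y i).trace.re ^ 2 = 1 := by
  have hb := fun k => clique_sum_le_one hρ hq k hs y
  have hs' : pauliSign (1 - l) (1 - l') * pauliSign (1 - m) (1 - m') = -1 := by
    simp only [pauliSign_sub_left, pauliSign_sub_right, neg_neg, hs]
  have hb' := fun k => clique_sum_le_one hρ hq k hs' (1 - y)
  have htot : ∑ k, (∑ i, (ρ * clique q k l m l' m' y i).trace.re ^ 2 +
      ∑ i, (ρ * clique q k (1 - l) (1 - m) (1 - l') (1 - m') (1 - y) i).trace.re ^ 2) = 4 := by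
    rw [← h4]
    simp only [sum_clique, T2triple_eq, Fin.sum_univ_two]
    fin_cases l <;> fin_cases m <;> fin_cases l' <;> fin_cases m' <;>
      first
        | exact absurd hs (by decide)
        | (fin_cases y <;> simp <;> ring)
  rw [Fin.sum_univ_two] at htot
  have h₀ := hb 0
  have h₁ := hb 1
  have h₀' := hb' 0
  have h₁' := hb' 1
  refine le_antisymm (hb k) ?_
  fin_cases k
  · change 1 ≤ ∑ i, (ρ * clique q 0 l m l' m' y i).trace.re ^ 2
    linarith
  · change 1 ≤ ∑ i, (ρ * clique q 1 l m l' m' y i).trace.re ^ 2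
    linarith

/-- If the monogamy relation of two hyperedges is attained and the second has nonzero Bell
strength, then the Bell strength of the next hyperedge vanishes. -/
lemma T2triple_eq_zero_of_add_eq_four (hρ : IsDensityMatrix ρ) (hq : q.Injective)
    (h4 : T2triple ρ (q 0) (q 1) (q 2) + T2triple ρ (q 2) (q 3) (q 4) = 4)
    (hne : T2triple ρ (q 2) (q 3) (q 4) ≠ 0) : T2triple ρ (q 4) (q 5) (q 6) = 0 := by
  obtain ⟨k, l, m, hklm⟩ :
      ∃ k l m, (ρ * tripleOp (q 2) (q 3) (q 4) k l m).trace.re ^ 2 ≠ 0 := by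
    by_contra! h
    exact hne (by simp only [T2triple_eq, h, Finset.sum_const_zero])
  have hs : pauliSign l l * pauliSign m (1 - m) = -1 := by
    rw [pauliSign_sub_right, pauliSign_self, pauliSign_self, one_mul]
  have hs' : pauliSign (1 - l) l * pauliSign (1 - m) (1 - m) = -1 := by
    rw [pauliSign_sub_left, pauliSign_self, pauliSign_self, mul_one]
  have stab := fun {l m l' m' : Fin 2} (h : pauliSign l l' * pauliSign m m' = -1) =>
    expectationSum_mul_eq hρ.1 hρ.2 (clique_isHermitian hq _ _ _ _ _ _)
      (clique_mul_self hq _ _ _ _ _ _) (clique_anticommute hq k h 0)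
      (clique_sum_eq_one hρ hq h4 k h 0)
  have hprop : (((ρ * tripleOp (q 2) (q 3) (q 4) k l m).trace.re : ℝ) : ℂ) •
      (tripleOp (q 2) (q 3) (q 4) k l m * ρ) =
      (((ρ * tripleOp (q 2) (q 3) (q 4) k (1 - l) (1 - m)).trace.re : ℝ) : ℂ) •
      (tripleOp (q 2) (q 3) (q 4) k (1 - l) (1 - m) * ρ) := by
    have h := (stab hs).trans (stab hs').symm
    simpa [expectationSum, clique, Fin.sum_univ_four, add_mul] using h
  have herm := fun l m => tripleOp_isHermitian (hq.ne (by decide : (2 : Fin 7) ≠ 3))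
    (hq.ne (by decide : (2 : Fin 7) ≠ 4)) (hq.ne (by decide : (3 : Fin 7) ≠ 4)) k l m
  have sq := fun l m => tripleOp_mul_self (hq.ne (by decide : (2 : Fin 7) ≠ 3))
    (hq.ne (by decide : (2 : Fin 7) ≠ 4)) (hq.ne (by decide : (3 : Fin 7) ≠ 4)) k l m
  have hadj : ∀ l m x y z, SignCommute (pauliSign m x) (tripleOp (q 2) (q 3) (q 4) k l m)
      (tripleOp (q 4) (q 5) (q 6) x y z) := fun l m x y z => by
    refine tripleOp_signCommute_adjacent ?_ ?_ ?_ ?_ ?_ ?_ ?_ ?_ _ _ _ _ _ _ <;>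
      exact hq.ne (by decide)
  have hzero : ∀ x y z, (ρ * tripleOp (q 4) (q 5) (q 6) x y z).trace = 0 := fun x y z => by
    have hc := hadj (1 - l) (1 - m) x y z
    rw [pauliSign_sub_left] at hc
    have ha : (ρ * tripleOp (q 2) (q 3) (q 4) k l m).trace.re ^ 2 +
        (ρ * tripleOp (q 2) (q 3) (q 4) k (1 - l) (1 - m)).trace.re ^ 2 ≠ 0 := by
      have := lt_of_le_of_ne (sq_nonneg _) hklm.symm
      exact ne_of_gt (add_pos_of_pos_of_nonneg this (sq_nonneg _))
    exact trace_eq_zero_of_proportional hρ.1.1 (herm l m) (herm (1 - l) (1 - m)) (sq l m)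
      (sq (1 - l) (1 - m)) ha hprop (pauliSign_eq m x) (hadj l m x y z) hc
  simp [T2triple_eq, hzero]

end Clique

/-- Reduction of a natural number label modulo the number of qubits. -/
def cyclicLabel (N : ℕ) [NeZero N] (a : ℕ) : Fin N := ⟨a % N, Nat.mod_lt _ (NeZero.pos N)⟩

lemma cyclicLabel_injective {N : ℕ} [NeZero N] (hN : 7 ≤ N) (a : ℕ) :
    Function.Injective fun i : Fin 7 => cyclicLabel N (a + i) := by
  intro i j hij
  have h : (a + i) % N = (a + j) % N := congrArg Fin.val hij
  have h' : (i : ℕ) % N = j % N := Nat.ModEq.add_left_cancel' a h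
  rw [Nat.mod_eq_of_lt (by omega), Nat.mod_eq_of_lt (by omega)] at h'
  exact Fin.ext h'

/-- An odd cycle of numbers with constant sum of neighbours is constant. -/
lemma eq_half_of_odd_cycle {f : ℕ → ℝ} {h : ℕ} (hodd : Odd h) (hper : f h = f 0) {c : ℝ}
    (hf : ∀ j < h, f j + f (j + 1) = 2 * c) : f 0 = c := by
  have key : ∀ j ≤ h, f j - c = (-1) ^ j * (f 0 - c) := by
    intro j
    induction j with
    | zero => simp
    | succ j ih =>
      intro hj
      rw [pow_succ]
      linear_combination hf j hj - ih (by omega)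
  have := key h le_rfl
  rw [hodd.neg_one_pow, hper] at this
  linarith

/-- **Strict cyclic monogamy for odd cycles.** For odd h ≥ 5 and the cyclic hypergraph C_h
on 2h qubits with hyperedges e_j = (2j−1, 2j, 2j+1) (labels mod 2h, here 0-indexed so that
e_j = (2j, 2j+1, 2j+2 mod 2h) for j = 0,…,h−1), no 2h-qubit density matrix attains the
averaged bound 2h: the inequality ∑_j 𝒯²_{e_j}(ρ) < 2h is strict. -/
theorem strict_cyclic_monogamy_odd (h : ℕ) (hh : 5 ≤ h) (hodd : Odd h)
    (ρ : Matrix (Fin (2 * h) → Fin 2) (Fin (2 * h) → Fin 2) ℂ) (hρ : IsDensityMatrix ρ) :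
    ∑ j : Fin h,
      T2triple ρ ⟨2 * j.val, by have := j.isLt; omega⟩
        ⟨2 * j.val + 1, by have := j.isLt; omega⟩
        ⟨(2 * j.val + 2) % (2 * h), Nat.mod_lt _ (by omega)⟩
      < 2 * h := by
  have : NeZero (2 * h) := ⟨by omega⟩
  set w := cyclicLabel (2 * h) with hw
  set F : ℕ → ℝ := fun j => T2triple ρ (w (2 * j)) (w (2 * j + 1)) (w (2 * j + 2)) with hF
  have hsum : ∑ j : Fin h,
      T2triple ρ ⟨2 * j.val, by have := j.isLt; omega⟩
        ⟨2 * j.val + 1, by have := j.isLt; omega⟩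
        ⟨(2 * j.val + 2) % (2 * h), Nat.mod_lt _ (by omega)⟩ = ∑ j ∈ Finset.range h, F j := by
    rw [← Fin.sum_univ_eq_sum_range]
    refine Finset.sum_congr rfl fun j _ => ?_
    have := j.isLt
    congr 1 <;> exact Fin.ext (Nat.mod_eq_of_lt (by omega)).symm
  have hper : F h = F 0 := by
    have hmod : ∀ a, w (2 * h + a) = w (2 * 0 + a) := fun a => Fin.ext (by simp [hw, cyclicLabel])
    have hmod₀ : w (2 * h) = w (2 * 0) := hmod 0
    simp only [hF, hmod, hmod₀]
  set q : ℕ → Fin 7 → Fin (2 * h) := fun j i => w (2 * j + i) with hq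
  have hinj : ∀ j, (q j).Injective := fun j => cyclicLabel_injective (by omega) (2 * j)
  have hF₀ : ∀ j, F j = T2triple ρ (q j 0) (q j 1) (q j 2) := fun j => by
    simp only [hF, hq]; congr 1
  have hF₁ : ∀ j, F (j + 1) = T2triple ρ (q j 2) (q j 3) (q j 4) := fun j => by
    simp only [hF, hq]; congr 1
  have hF₂ : ∀ j, F (j + 2) = T2triple ρ (q j 4) (q j 5) (q j 6) := fun j => by
    simp only [hF, hq]; congr 1
  have hle : ∀ j, F j + F (j + 1) ≤ 4 := fun j => by
    rw [hF₀, hF₁]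
    exact T2triple_add_le_four hρ (hinj j)
  have hshift : ∑ j ∈ Finset.range h, F (j + 1) = ∑ j ∈ Finset.range h, F j := by
    have := (Finset.sum_range_succ F h).symm.trans (Finset.sum_range_succ' F h)
    linarith
  rw [hsum]
  by_contra! hge
  have heq : ∀ j < h, F j + F (j + 1) = 2 * 2 := by
    have htot : ∑ j ∈ Finset.range h, (F j + F (j + 1)) = ∑ _j ∈ Finset.range h, (4 : ℝ) := by
      refine le_antisymm (Finset.sum_le_sum fun j _ => hle j) ?_
      rw [Finset.sum_add_distrib, hshift, Finset.sum_const, Finset.card_range, nsmul_eq_mul]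
      linarith
    intro j hj
    rw [(Finset.sum_eq_sum_iff_of_le fun j _ => hle j).1 htot j (Finset.mem_range.2 hj)]
    norm_num
  have h0 : F 0 = 2 := eq_half_of_odd_cycle hodd hper heq
  have h01 := heq 0 (by omega)
  have h12 := heq 1 (by omega)
  have h1 : F (0 + 1) = 2 := by linarith
  have h2 : F (0 + 2) = 0 := by
    rw [hF₂]
    rw [hF₀, hF₁] at h01
    rw [hF₁] at h1
    exact T2triple_eq_zero_of_add_eq_four hρ (hinj 0) (by linarith) (by linarith)
  norm_num at h1 h2 h12
  linarith
end
end

section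
/- Product bound from marginal expectation values: Let A be a Hermitian d_A × d_A complex matrix with A² = I and B a Hermitian d_B × d_B complex matrix with B² = I, and let ρ be a density matrix on ℂ^{d_A} ⊗ ℂ^{d_B}. Write ⟨A⟩ = Tr(ρ (A ⊗ I)), ⟨B⟩ = Tr(ρ (I ⊗ B)) and ⟨A ⊗ B⟩ = Tr(ρ (A ⊗ B)). If |⟨A⟩| + |⟨B⟩| ≥ 1, then ⟨A ⊗ B⟩² ≥ (|⟨A⟩| + |⟨B⟩| − 1)². -/
open Matrix Complex ComplexOrder Kronecker

/-- The trace of a positive semidefinite matrix against a Hermitian matrix `K` with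
`K * K = 4 • K` is nonnegative. -/
theorem trace_mul_re_nonneg_of_sq_eq_four_smul {n : Type*} [Fintype n] {ρ K : Matrix n n ℂ}
    (hρ : ρ.PosSemidef) (hK : K.IsHermitian) (hK2 : K * K = (4 : ℂ) • K) :
    0 ≤ (ρ * K).trace.re := by
  have h := (hρ.conjTranspose_mul_mul_same K).trace_nonneg
  rw [hK.eq, Matrix.trace_mul_comm, ← Matrix.mul_assoc, hK2, Matrix.smul_mul,
    Matrix.trace_smul, Matrix.trace_mul_comm] at h
  simpa using (Complex.le_def.mp h).1

/-- The joint probability of the outcome `(+1, +1)` for two local dichotomic observables is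
nonnegative. -/
theorem one_add_marginals_add_correlation_nonneg {m n : Type*} [Fintype m] [Fintype n]
    [DecidableEq m] [DecidableEq n] {A : Matrix m m ℂ} {B : Matrix n n ℂ}
    (hA : A.IsHermitian) (hA2 : A * A = 1) (hB : B.IsHermitian) (hB2 : B * B = 1)
    {ρ : Matrix (m × n) (m × n) ℂ} (hρ : ρ.PosSemidef) (htr : ρ.trace = 1) :
    0 ≤ 1 + (ρ * (A ⊗ₖ (1 : Matrix n n ℂ))).trace.re
        + (ρ * ((1 : Matrix m m ℂ) ⊗ₖ B)).trace.re + (ρ * (A ⊗ₖ B)).trace.re := by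
  have hP : (1 + A) * (1 + A) = (2 : ℂ) • (1 + A) := by
    rw [mul_add, add_mul, add_mul, hA2, two_smul]
    simp only [one_mul, mul_one]
    abel
  have hQ : (1 + B) * (1 + B) = (2 : ℂ) • (1 + B) := by
    rw [mul_add, add_mul, add_mul, hB2, two_smul]
    simp only [one_mul, mul_one]
    abel
  have hK : ((1 + A) ⊗ₖ (1 + B)).IsHermitian := by
    rw [Matrix.IsHermitian, Matrix.conjTranspose_kronecker, (Matrix.isHermitian_one.add hA).eq,
      (Matrix.isHermitian_one.add hB).eq]
  have hK2 : ((1 + A) ⊗ₖ (1 + B)) * ((1 + A) ⊗ₖ (1 + B)) = (4 : ℂ) • ((1 + A) ⊗ₖ (1 + B)) := by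
    rw [← Matrix.mul_kronecker_mul, hP, hQ, Matrix.smul_kronecker, Matrix.kronecker_smul, smul_smul]
    norm_num
  have h := trace_mul_re_nonneg_of_sq_eq_four_smul hρ hK hK2
  rw [Matrix.add_kronecker, Matrix.kronecker_add, Matrix.kronecker_add,
    Matrix.one_kronecker_one] at h
  simp only [mul_add, mul_one, Matrix.trace_add, htr, Complex.add_re, Complex.one_re] at h
  linarith

/-- **Product bound from marginal expectation values.** For dichotomic observables `A`, `B`
on the two factors of a bipartite system and any density matrix `ρ`, if
`|⟨A⟩| + |⟨B⟩| ≥ 1` then `⟨A ⊗ B⟩² ≥ (|⟨A⟩| + |⟨B⟩| − 1)²`. -/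
theorem product_bound_from_marginals {dA dB : ℕ}
    (A : Matrix (Fin dA) (Fin dA) ℂ) (B : Matrix (Fin dB) (Fin dB) ℂ)
    (hA : A.IsHermitian) (hA2 : A * A = 1)
    (hB : B.IsHermitian) (hB2 : B * B = 1)
    (ρ : Matrix (Fin dA × Fin dB) (Fin dA × Fin dB) ℂ)
    (hρ : ρ.PosSemidef) (htr : ρ.trace = 1)
    (h : 1 ≤ |(ρ * (A ⊗ₖ (1 : Matrix (Fin dB) (Fin dB) ℂ))).trace.re| +
          |(ρ * ((1 : Matrix (Fin dA) (Fin dA) ℂ) ⊗ₖ B)).trace.re|) :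
    (|(ρ * (A ⊗ₖ (1 : Matrix (Fin dB) (Fin dB) ℂ))).trace.re| +
        |(ρ * ((1 : Matrix (Fin dA) (Fin dA) ℂ) ⊗ₖ B)).trace.re| - 1) ^ 2
      ≤ ((ρ * (A ⊗ₖ B)).trace.re) ^ 2 := by
  have neg_left {l n : ℕ} (X : Matrix (Fin l) (Fin l) ℂ) (Y : Matrix (Fin n) (Fin n) ℂ) :
      (-X) ⊗ₖ Y = -(X ⊗ₖ Y) := by
    ext; simp
  have neg_right {l n : ℕ} (X : Matrix (Fin l) (Fin l) ℂ) (Y : Matrix (Fin n) (Fin n) ℂ) :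
      X ⊗ₖ (-Y) = -(X ⊗ₖ Y) := by
    ext; simp
  have hA2' : -A * -A = 1 := by rw [neg_mul_neg, hA2]
  have hB2' : -B * -B = 1 := by rw [neg_mul_neg, hB2]
  have hpp := one_add_marginals_add_correlation_nonneg hA hA2 hB hB2 hρ htr
  have hnp := one_add_marginals_add_correlation_nonneg hA.neg hA2' hB hB2 hρ htr
  have hpn := one_add_marginals_add_correlation_nonneg hA hA2 hB.neg hB2' hρ htr
  have hnn := one_add_marginals_add_correlation_nonneg hA.neg hA2' hB.neg hB2' hρ htr
  simp only [neg_left, neg_right, neg_neg, mul_neg, Matrix.trace_neg, Complex.neg_re]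
    at hnp hpn hnn
  rw [sq_le_sq, abs_of_nonneg (sub_nonneg.mpr h), le_abs]
  rcases abs_cases (ρ * (A ⊗ₖ (1 : Matrix (Fin dB) (Fin dB) ℂ))).trace.re with ⟨ha, _⟩ | ⟨ha, _⟩ <;>
  rcases abs_cases (ρ * ((1 : Matrix (Fin dA) (Fin dA) ℂ) ⊗ₖ B)).trace.re with ⟨hb, _⟩ | ⟨hb, _⟩ <;>
  rw [ha, hb] <;>
  first
  | exact Or.inl (by linarith)
  | exact Or.inr (by linarith)
end

section
/- Two-sided bound relating a product observable to its marginals: Let A be a Hermitian d_A × d_A complex matrix with A² = I and B a Hermitian d_B × d_B complex matrix with B² = I, and let ρ be a density matrix on ℂ^{d_A} ⊗ ℂ^{d_B}. Write ⟨A⟩ = Tr(ρ (A ⊗ I)), ⟨B⟩ = Tr(ρ (I ⊗ B)) and ⟨A ⊗ B⟩ = Tr(ρ (A ⊗ B)). Then −1 + |⟨A⟩ + ⟨B⟩| ≤ ⟨A ⊗ B⟩ ≤ 1 − |⟨A⟩ − ⟨B⟩|. -/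
open Matrix Complex ComplexOrder Kronecker

/-- If `ρ` is positive semidefinite and `X`, `Y` are commuting Hermitian involutions, then
`Tr (ρ (1 + X) (1 + Y))` has nonnegative real part. -/
lemma re_trace_mul_one_add_mul_one_add_nonneg {n : Type*} [Fintype n] [DecidableEq n]
    {ρ X Y : Matrix n n ℂ} (hρ : ρ.PosSemidef)
    (hX : X.IsHermitian) (hX2 : X * X = 1) (hY : Y.IsHermitian) (hY2 : Y * Y = 1)
    (hXY : Commute X Y) :
    0 ≤ ρ.trace.re + (ρ * X).trace.re + (ρ * Y).trace.re + (ρ * (X * Y)).trace.re := by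
  set M : Matrix n n ℂ := (1 + X) * (1 + Y) with hM
  have hcomm : Commute (1 + X) (1 + Y) :=
    (Commute.one_left _).add_left ((Commute.one_right X).add_right hXY)
  have hMH : Mᴴ = M := by
    rw [hM, conjTranspose_mul, conjTranspose_add, conjTranspose_add, conjTranspose_one,
      hX.eq, hY.eq, hcomm.eq]
  have hsq {Z : Matrix n n ℂ} (hZ : Z * Z = 1) :
      (1 + Z) * (1 + Z) = (2 : ℂ) • (1 + Z) := by
    rw [add_mul, mul_add, mul_add, hZ, two_smul]
    simp only [one_mul, mul_one]
    abel
  have hMM : M * M = (4 : ℂ) • M := by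
    rw [hM, hcomm.symm.mul_mul_mul_comm, hsq hX2, hsq hY2, smul_mul_smul_comm]
    norm_num
  have htrace : (Mᴴ * ρ * M).trace = 4 * (ρ * M).trace := by
    rw [hMH, trace_mul_cycle, hMM, smul_mul_assoc, trace_smul, trace_mul_comm, smul_eq_mul]
  have hpos : 0 ≤ (Mᴴ * ρ * M).trace.re :=
    (Complex.nonneg_iff.mp (hρ.conjTranspose_mul_mul_same M).trace_nonneg).1
  have hexp : (ρ * M).trace =
      ρ.trace + (ρ * X).trace + (ρ * Y).trace + (ρ * (X * Y)).trace := by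
    simp only [hM, ← trace_add]
    congr 1
    noncomm_ring
  rw [htrace, hexp] at hpos
  simp only [mul_re, add_re, re_ofNat, im_ofNat, zero_mul, sub_zero] at hpos
  linarith

/-- **Two-sided bound relating a product observable to its marginals.** For dichotomic
observables `A`, `B` on the two factors of a bipartite system and any density matrix `ρ`,
`−1 + |⟨A⟩ + ⟨B⟩| ≤ ⟨A ⊗ B⟩ ≤ 1 − |⟨A⟩ − ⟨B⟩|`. -/
theorem two_sided_product_bound {dA dB : ℕ}
    (A : Matrix (Fin dA) (Fin dA) ℂ) (B : Matrix (Fin dB) (Fin dB) ℂ)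
    (hA : A.IsHermitian) (hA2 : A * A = 1)
    (hB : B.IsHermitian) (hB2 : B * B = 1)
    (ρ : Matrix (Fin dA × Fin dB) (Fin dA × Fin dB) ℂ)
    (hρ : ρ.PosSemidef) (htr : ρ.trace = 1) :
    -1 + |(ρ * (A ⊗ₖ (1 : Matrix (Fin dB) (Fin dB) ℂ))).trace.re +
        (ρ * ((1 : Matrix (Fin dA) (Fin dA) ℂ) ⊗ₖ B)).trace.re|
      ≤ (ρ * (A ⊗ₖ B)).trace.re ∧
    (ρ * (A ⊗ₖ B)).trace.re
      ≤ 1 - |(ρ * (A ⊗ₖ (1 : Matrix (Fin dB) (Fin dB) ℂ))).trace.re -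
          (ρ * ((1 : Matrix (Fin dA) (Fin dA) ℂ) ⊗ₖ B)).trace.re| := by
  set X := A ⊗ₖ (1 : Matrix (Fin dB) (Fin dB) ℂ) with hXdef
  set Y := (1 : Matrix (Fin dA) (Fin dA) ℂ) ⊗ₖ B with hYdef
  have hXY : X * Y = A ⊗ₖ B := by
    rw [hXdef, hYdef, ← mul_kronecker_mul, mul_one, one_mul]
  have hYX : Y * X = A ⊗ₖ B := by
    rw [hXdef, hYdef, ← mul_kronecker_mul, mul_one, one_mul]
  have hcomm : Commute X Y := hXY.trans hYX.symm
  have hX : X.IsHermitian := by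
    rw [IsHermitian, hXdef, conjTranspose_kronecker, hA.eq, conjTranspose_one]
  have hY : Y.IsHermitian := by
    rw [IsHermitian, hYdef, conjTranspose_kronecker, hB.eq, conjTranspose_one]
  have hX2 : X * X = 1 := by
    rw [hXdef, ← mul_kronecker_mul, hA2, mul_one, one_kronecker_one]
  have hY2 : Y * Y = 1 := by
    rw [hYdef, ← mul_kronecker_mul, hB2, mul_one, one_kronecker_one]
  have hnX2 : -X * -X = 1 := by rw [neg_mul_neg, hX2]
  have hnY2 : -Y * -Y = 1 := by rw [neg_mul_neg, hY2]
  have hpp := re_trace_mul_one_add_mul_one_add_nonneg hρ hX hX2 hY hY2 hcomm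
  have hpm := re_trace_mul_one_add_mul_one_add_nonneg hρ hX hX2 hY.neg hnY2 hcomm.neg_right
  have hmp := re_trace_mul_one_add_mul_one_add_nonneg hρ hX.neg hnX2 hY hY2 hcomm.neg_left
  have hmm := re_trace_mul_one_add_mul_one_add_nonneg hρ hX.neg hnX2 hY.neg hnY2
    hcomm.neg_left.neg_right
  simp only [mul_neg, neg_mul, neg_neg, trace_neg, neg_re, htr, one_re, hXY] at hpp hpm hmp hmm
  constructor
  · rw [← le_sub_iff_add_le', abs_le]
    constructor <;> linarith
  · rw [le_sub_comm, abs_le]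
    constructor <;> linarith
end

section
/- Quantum realizability of the Steinmetz solid in the star configuration: Let n ≥ 2 and consider n+1 qubits labeled 1, 2, …, n+1, with qubit 1 central. Suppose b₂, …, b_{n+1} are nonnegative real numbers satisfying b_j² + b_k² ≤ 2 for all j ≠ k in {2,…,n+1}. Then there exists an (n+1)-qubit density matrix ρ such that for every j ∈ {2,…,n+1}, Σ_{k,l ∈ {x,z}} (Tr(ρ σ_k^{(1)} σ_l^{(j)}))² = b_j². -/
open Matrix Complex ComplexOrder

noncomputable section

/-- Entries of a product of two single-site operators acting on different qubits. -/
lemma onQubit_mul_onQubit_apply {n : ℕ} (M N : Matrix (Fin 2) (Fin 2) ℂ) {i j : Fin n}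
    (hij : i ≠ j) (a b : Fin n → Fin 2) :
    (onQubit M i * onQubit N j) a b =
      ∏ s, if s = i then M (a s) (b s) else if s = j then N (a s) (b s)
        else if a s = b s then 1 else 0 := by
  simp only [Matrix.mul_apply, onQubit, Matrix.of_apply, ← Finset.prod_mul_distrib]
  rw [← Fintype.piFinset_univ, ← Finset.prod_univ_sum (fun _ => Finset.univ)
    (fun s x => (if s = i then M (a s) x else if a s = x then 1 else 0) *
      (if s = j then N x (b s) else if x = b s then 1 else 0))]
  refine Finset.prod_congr rfl fun s _ => ?_
  by_cases hi : s = i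
  · have hj : s ≠ j := hi ▸ hij
    simp [hi, hij]
  · by_cases hj : s = j <;> simp [hi, hj, hij.symm]

/-- Entries of an operator acting on the central qubit and on one satellite. -/
lemma onQubit_zero_mul_onQubit_succ_apply {n : ℕ} (M N : Matrix (Fin 2) (Fin 2) ℂ) (j : Fin n)
    (x y : Fin 2) (c d : Fin n → Fin 2) :
    (onQubit M 0 * onQubit N j.succ : Matrix (Fin (n + 1) → Fin 2) (Fin (n + 1) → Fin 2) ℂ)
        (Fin.cons x c) (Fin.cons y d) =
      M x y * ∏ s, if s = j then N (c s) (d s) else if c s = d s then 1 else 0 := by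
  rw [onQubit_mul_onQubit_apply M N (Fin.succ_ne_zero j).symm, Fin.prod_univ_succ]
  simp

/-- Flip the bit at position `m`. -/
def flipBit {n : ℕ} (m : Fin n) (c : Fin n → Fin 2) : Fin n → Fin 2 :=
  Function.update c m (c m + 1)

/-- The vector `α |0, c⟩ + β |1, c ⊕ e_m⟩`. -/
def starVec {n : ℕ} (α β : ℝ) (m : Fin n) (c : Fin n → Fin 2) : (Fin (n + 1) → Fin 2) → ℂ :=
  (α : ℂ) • Pi.single (Fin.cons 0 c) 1 + (β : ℂ) • Pi.single (Fin.cons 1 (flipBit m c)) 1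

/-- The eigenvalue of the Pauli Z matrix on a basis vector. -/
def zSign (x : Fin 2) : ℝ := if x = 0 then 1 else -1

/-- The product distribution on bit strings whose `i`-th bit has mean sign `t i`. -/
def bitWeight {n : ℕ} (t : Fin n → ℝ) (c : Fin n → Fin 2) : ℝ :=
  ∏ i, (1 + t i * zSign (c i)) / 2

/-- The mixture of the states `starVec α β m c` with weights `bitWeight t c`. -/
def starState {n : ℕ} (α β : ℝ) (m : Fin n) (t : Fin n → ℝ) :
    Matrix (Fin (n + 1) → Fin 2) (Fin (n + 1) → Fin 2) ℂ :=
  ∑ c, (bitWeight t c : ℂ) • vecMulVec (starVec α β m c) (star (starVec α β m c))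

lemma bitWeight_nonneg {n : ℕ} {t : Fin n → ℝ} (ht : ∀ i, |t i| ≤ 1) (c : Fin n → Fin 2) :
    0 ≤ bitWeight t c := by
  refine Finset.prod_nonneg fun i _ => ?_
  obtain ⟨h₁, h₂⟩ := abs_le.mp (ht i)
  unfold zSign
  split_ifs <;> linarith

lemma sum_bitWeight {n : ℕ} (t : Fin n → ℝ) : ∑ c, bitWeight t c = 1 := by
  unfold bitWeight
  rw [← Fintype.piFinset_univ, ← Finset.prod_univ_sum (fun _ => Finset.univ)
    (fun i x => (1 + t i * zSign x) / 2)]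
  refine Finset.prod_eq_one fun i _ => ?_
  simp [Fin.sum_univ_two, zSign]
  ring

lemma sum_bitWeight_mul_zSign {n : ℕ} (t : Fin n → ℝ) (j : Fin n) :
    ∑ c, bitWeight t c * zSign (c j) = t j := by
  have h : ∀ c : Fin n → Fin 2, bitWeight t c * zSign (c j) =
      ∏ i, (1 + t i * zSign (c i)) / 2 * (if i = j then zSign (c i) else 1) := by
    intro c
    rw [Finset.prod_mul_distrib, Finset.prod_ite_eq' Finset.univ j]
    simp [bitWeight]
  simp only [h]
  rw [← Fintype.piFinset_univ, ← Finset.prod_univ_sum (fun _ => Finset.univ)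
    (fun i x => (1 + t i * zSign x) / 2 * (if i = j then zSign x else 1)),
    Finset.prod_eq_single j]
  · simp [Fin.sum_univ_two, zSign]
    ring
  · intro i _ hi
    simp [Fin.sum_univ_two, zSign, hi]
    ring
  · simp

lemma flipBit_ne {n : ℕ} (m : Fin n) (c : Fin n → Fin 2) : flipBit m c m ≠ c m := by
  simp [flipBit]

lemma star_starVec {n : ℕ} (α β : ℝ) (m : Fin n) (c : Fin n → Fin 2) :
    star (starVec α β m c) = starVec α β m c := by
  ext a
  simp only [starVec, Pi.star_apply, Pi.add_apply, Pi.smul_apply, Pi.single_apply]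
  split_ifs <;> simp

lemma trace_starState_mul {n : ℕ} (α β : ℝ) (m : Fin n) (t : Fin n → ℝ)
    (A : Matrix (Fin (n + 1) → Fin 2) (Fin (n + 1) → Fin 2) ℂ) :
    (starState α β m t * A).trace = ∑ c, (bitWeight t c : ℂ) *
      (α ^ 2 * A (Fin.cons 0 c) (Fin.cons 0 c)
        + α * β * (A (Fin.cons 0 c) (Fin.cons 1 (flipBit m c))
          + A (Fin.cons 1 (flipBit m c)) (Fin.cons 0 c))
        + β ^ 2 * A (Fin.cons 1 (flipBit m c)) (Fin.cons 1 (flipBit m c))) := by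
  unfold starState
  rw [Finset.sum_mul, Matrix.trace_sum]
  refine Finset.sum_congr rfl fun c _ => ?_
  rw [Matrix.smul_mul, Matrix.trace_smul, smul_eq_mul, star_starVec, vecMulVec_mul,
    trace_vecMulVec]
  congr 1
  simp only [starVec, Matrix.add_vecMul, Matrix.smul_vecMul, Matrix.single_one_vecMul,
    add_dotProduct, dotProduct_add, smul_dotProduct, dotProduct_smul, single_one_dotProduct,
    smul_eq_mul, Matrix.row_apply]
  ring

lemma isDensityMatrix_starState {n : ℕ} {α β : ℝ} (hαβ : α ^ 2 + β ^ 2 = 1) (m : Fin n)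
    {t : Fin n → ℝ} (ht : ∀ i, |t i| ≤ 1) : IsDensityMatrix (starState α β m t) := by
  constructor
  · refine Matrix.posSemidef_sum _ fun c _ => ?_
    refine (Matrix.posSemidef_vecMulVec_self_star _).smul ?_
    exact_mod_cast bitWeight_nonneg ht c
  · have h := trace_starState_mul α β m t 1
    rw [mul_one] at h
    rw [h]
    have hαβ' : (α : ℂ) ^ 2 + (β : ℂ) ^ 2 = 1 := by exact_mod_cast hαβ
    have hs : ∑ c, (bitWeight t c : ℂ) = 1 := by exact_mod_cast sum_bitWeight t
    simp [Fin.cons_inj, hαβ', hs]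

/-- The off-diagonal satellite factor between a bit string and its flip. -/
lemma prod_flipBit {n : ℕ} (N : Matrix (Fin 2) (Fin 2) ℂ) (m j : Fin n) (c : Fin n → Fin 2) :
    (∏ s, if s = j then N (c s) (flipBit m c s) else if c s = flipBit m c s then 1 else 0) =
      if j = m then N (c m) (c m + 1) else 0 := by
  split_ifs with h
  · subst h
    rw [Finset.prod_eq_single j]
    · simp [flipBit]
    · intro s _ hs
      simp [flipBit, hs]
    · simp
  · refine Finset.prod_eq_zero (Finset.mem_univ m) ?_
    simp [Ne.symm h, (flipBit_ne m c).symm]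

lemma prod_flipBit' {n : ℕ} (N : Matrix (Fin 2) (Fin 2) ℂ) (m j : Fin n) (c : Fin n → Fin 2) :
    (∏ s, if s = j then N (flipBit m c s) (c s) else if flipBit m c s = c s then 1 else 0) =
      if j = m then N (c m + 1) (c m) else 0 := by
  have h := prod_flipBit Nᵀ m j c
  simpa only [Matrix.transpose_apply, eq_comm (a := c _)] using h

lemma trace_starState_mul_onQubit {n : ℕ} (α β : ℝ) (m j : Fin n) (t : Fin n → ℝ)
    (M N : Matrix (Fin 2) (Fin 2) ℂ) :
    (starState α β m t * (onQubit M 0 * onQubit N j.succ)).trace =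
      ∑ c, (bitWeight t c : ℂ) *
        (α ^ 2 * (M 0 0 * N (c j) (c j))
          + α * β * (M 0 1 * (if j = m then N (c m) (c m + 1) else 0)
            + M 1 0 * (if j = m then N (c m + 1) (c m) else 0))
          + β ^ 2 * (M 1 1 * N (flipBit m c j) (flipBit m c j))) := by
  simp only [trace_starState_mul, onQubit_zero_mul_onQubit_succ_apply, prod_flipBit,
    prod_flipBit', if_true, Finset.prod_ite_eq', Finset.mem_univ]

lemma pX_diag (x : Fin 2) : pX x x = 0 := by fin_cases x <;> simp [pX]

lemma pX_flip (x : Fin 2) : pX x (x + 1) = 1 := by fin_cases x <;> simp [pX]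

lemma pX_flip' (x : Fin 2) : pX (x + 1) x = 1 := by fin_cases x <;> simp [pX]

lemma pZ_diag (x : Fin 2) : pZ x x = zSign x := by fin_cases x <;> simp [pZ, zSign]

lemma pZ_flip (x : Fin 2) : pZ x (x + 1) = 0 := by fin_cases x <;> simp [pZ]

lemma pZ_flip' (x : Fin 2) : pZ (x + 1) x = 0 := by fin_cases x <;> simp [pZ]

lemma zSign_add_one (x : Fin 2) : zSign (x + 1) = -zSign x := by
  fin_cases x <;> simp [zSign]

lemma T2pairXZ_starState {n : ℕ} {α β : ℝ} (hαβ : α ^ 2 + β ^ 2 = 1) (m j : Fin n)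
    (t : Fin n → ℝ) :
    T2pairXZ (starState α β m t) 0 j.succ =
      if j = m then (2 * α * β) ^ 2 + t m ^ 2 else ((α ^ 2 - β ^ 2) * t j) ^ 2 := by
  have hs : ∑ c, (bitWeight t c : ℂ) = 1 := by exact_mod_cast sum_bitWeight t
  have hz : ∑ c, (bitWeight t c : ℂ) * (zSign (c j) : ℂ) = t j := by
    exact_mod_cast sum_bitWeight_mul_zSign t j
  have hαβ' : (α : ℂ) ^ 2 + (β : ℂ) ^ 2 = 1 := by exact_mod_cast hαβ
  have hXX : (starState α β m t * (onQubit pX 0 * onQubit pX j.succ)).trace =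
      ((if j = m then 2 * α * β else 0 : ℝ) : ℂ) := by
    rw [trace_starState_mul_onQubit]
    simp only [pX_diag, pX_flip, pX_flip', mul_zero, zero_add, add_zero, ← Finset.sum_mul, hs]
    split_ifs <;> simp [pX]
    ring
  have hXZ : (starState α β m t * (onQubit pX 0 * onQubit pZ j.succ)).trace = 0 := by
    rw [trace_starState_mul_onQubit]
    simp [pX_diag, pZ_flip, pZ_flip']
  have hZX : (starState α β m t * (onQubit pZ 0 * onQubit pX j.succ)).trace = 0 := by
    rw [trace_starState_mul_onQubit]
    simp [pX_diag, pZ]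
  have hZZ : (starState α β m t * (onQubit pZ 0 * onQubit pZ j.succ)).trace =
      ((if j = m then t m else (α ^ 2 - β ^ 2) * t j : ℝ) : ℂ) := by
    rw [trace_starState_mul_onQubit]
    have hterm : ∀ c : Fin n → Fin 2, (bitWeight t c : ℂ) *
        (α ^ 2 * (pZ 0 0 * pZ (c j) (c j))
          + α * β * (pZ 0 1 * (if j = m then pZ (c m) (c m + 1) else 0)
            + pZ 1 0 * (if j = m then pZ (c m + 1) (c m) else 0))
          + β ^ 2 * (pZ 1 1 * pZ (flipBit m c j) (flipBit m c j))) =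
        ((bitWeight t c : ℂ) * zSign (c j)) * (if j = m then 1 else (α : ℂ) ^ 2 - β ^ 2) := by
      intro c
      rw [pZ_flip, pZ_flip', pZ_diag, pZ_diag, pZ_diag, pZ_diag]
      split_ifs with h
      · subst h
        simp only [flipBit, Function.update_self, zSign_add_one, ← hαβ']
        simp [zSign]
        ring
      · simp only [flipBit, Function.update_of_ne h]
        simp [zSign]
        ring
    rw [Finset.sum_congr rfl fun c _ => hterm c, ← Finset.sum_mul, hz]
    split_ifs with h
    · simp [h]
    · push_cast
      ring
  simp only [T2pairXZ, Fin.sum_univ_two, XZ, Matrix.cons_val_zero, Matrix.cons_val_one,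
    hXX, hXZ, hZX, hZZ, Complex.ofReal_re, Complex.zero_re]
  split_ifs <;> ring

/-- **Quantum realizability of the Steinmetz solid in the star configuration.** For n ≥ 2
satellite qubits (labeled by `j : Fin n`, with qubit `0` central and satellite `j`
corresponding to qubit `j.succ`) and nonnegative values `b j` satisfying the elementary
monogamy constraints `(b j)² + (b k)² ≤ 2` for all `j ≠ k`, there is an (n+1)-qubit density
matrix whose xz-plane Bell strength of the pair (0, j.succ) equals `(b j)²` for every j. -/
theorem steinmetz_star_realizable (n : ℕ) (hn : 2 ≤ n) (b : Fin n → ℝ)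
    (hb : ∀ j, 0 ≤ b j)
    (hmono : ∀ j k : Fin n, j ≠ k → (b j) ^ 2 + (b k) ^ 2 ≤ 2) :
    ∃ ρ : Matrix (Fin (n + 1) → Fin 2) (Fin (n + 1) → Fin 2) ℂ,
      IsDensityMatrix ρ ∧ ∀ j : Fin n, T2pairXZ ρ 0 j.succ = (b j) ^ 2 := by
  have : Nontrivial (Fin n) := Fin.nontrivial_iff_two_le.mpr hn
  by_cases hle : ∀ j, b j ≤ 1
  · have h10 : (1 : ℝ) ^ 2 + 0 ^ 2 = 1 := by norm_num
    refine ⟨starState 1 0 ⟨0, by omega⟩ b, isDensityMatrix_starState h10 _ fun i => ?_,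
      fun j => ?_⟩
    · rw [abs_of_nonneg (hb i)]
      exact hle i
    · rw [T2pairXZ_starState h10]
      split_ifs with h
      · rw [h]
        ring
      · ring
  · push Not at hle
    obtain ⟨m, hm⟩ := hle
    obtain ⟨k, hk⟩ := exists_ne m
    have hm2 : b m ^ 2 ≤ 2 := by nlinarith [hmono k m hk, sq_nonneg (b k)]
    set C := √(2 - b m ^ 2) with hC
    have hC0 : 0 ≤ C := Real.sqrt_nonneg _
    have hCsq : C ^ 2 = 2 - b m ^ 2 := Real.sq_sqrt (by linarith)
    have hC1 : C ≤ 1 := by nlinarith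
    have hα : √((1 + C) / 2) ^ 2 = (1 + C) / 2 := Real.sq_sqrt (by linarith)
    have hβ : √((1 - C) / 2) ^ 2 = (1 - C) / 2 := Real.sq_sqrt (by linarith)
    have hαβ : √((1 + C) / 2) ^ 2 + √((1 - C) / 2) ^ 2 = 1 := by
      rw [hα, hβ]
      ring
    have hbC : ∀ j, j ≠ m → b j ≤ C := fun j hj =>
      Real.le_sqrt_of_sq_le (by linarith [hmono j m hj])
    refine ⟨starState √((1 + C) / 2) √((1 - C) / 2) m (fun j => if j = m then 1 else b j / C),
      isDensityMatrix_starState hαβ _ fun i => ?_, fun j => ?_⟩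
    · split_ifs with h
      · simp
      · rw [abs_of_nonneg (div_nonneg (hb i) hC0)]
        exact div_le_one_of_le₀ (hbC i h) hC0
    · rw [T2pairXZ_starState hαβ]
      by_cases h : j = m
      · rw [if_pos h, if_pos rfl, h, mul_pow, mul_pow, hα, hβ]
        linarith
      · have h0 : C = 0 → b j = 0 := fun hz => le_antisymm (hz ▸ hbC j h) (hb j)
        rw [if_neg h, if_neg h, hα, hβ, show (1 + C) / 2 - (1 - C) / 2 = C by ring,
          mul_div_cancel_of_imp' h0]
end
end
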